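/- Let C be a finite category. Then there are only finitely many simple C-sets up to isomorphism: there exist finitely many C-sets Σ₁, …, Σₖ such that every simple C-set is isomorphic to some Σᵢ. -/

import Mathlib

open CategoryTheory

universe v u

section Defs

variable {C : Type u} [Category.{v} C]

/-- `S` is a subfunctor of the `C`-set `Ω`: a family of subsets `S x ⊆ Ω(x)` such that
`Ω(f)(S x) ⊆ S y` for every morphism `f : x ⟶ y`. -/
def IsSubfunctor (Ω : C ⥤ FintypeCat) (S : ∀ x : C, Set (Ω.obj x)) : Prop :=
  ∀ ⦃x y : C⦄ (f : x ⟶ y), ∀ a ∈ S x, Ω.map f a ∈ S y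

/-- A `C`-set is nonempty if it has a nonempty value at some object. -/
def CSetNonempty (Ω : C ⥤ FintypeCat) : Prop :=
  ∃ x : C, Nonempty (Ω.obj x)

/-- A `C`-set is indecomposable if it is nonempty and whenever two subfunctors are
pointwise disjoint with pointwise union all of `Ω`, one of them is pointwise empty. -/
def Indecomposable (Ω : C ⥤ FintypeCat) : Prop :=
  CSetNonempty Ω ∧
    ∀ S T : ∀ x : C, Set (Ω.obj x), IsSubfunctor Ω S → IsSubfunctor Ω T →
      (∀ x, S x ∩ T x = ∅) → (∀ x, S x ∪ T x = Set.univ) →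
      (∀ x, S x = ∅) ∨ (∀ x, T x = ∅)

/-- A `C`-set is simple if it is nonempty and its only subfunctors are the pointwise
empty one and the whole functor. -/
def SimpleCSet (Ω : C ⥤ FintypeCat) : Prop :=
  CSetNonempty Ω ∧
    ∀ S : ∀ x : C, Set (Ω.obj x), IsSubfunctor Ω S →
      (∀ x, S x = ∅) ∨ (∀ x, S x = Set.univ)

/-- One step of a zigzag in the category of elements of `Ω`: a morphism of `C` carrying
one element to the other, in one direction or the other. -/
def ElemStep (Ω : C ⥤ FintypeCat) : (Σ x : C, Ω.obj x) → (Σ x : C, Ω.obj x) → Prop :=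
  fun p q => (∃ f : p.1 ⟶ q.1, Ω.map f p.2 = q.2) ∨ ∃ f : q.1 ⟶ p.1, Ω.map f q.2 = p.2

/-- Two elements of a `C`-set are connected by a walk, i.e. by a zigzag in the category
of elements of `Ω`. -/
def WalkConnected (Ω : C ⥤ FintypeCat) (p q : Σ x : C, Ω.obj x) : Prop :=
  Relation.ReflTransGen (ElemStep Ω) p q

end Defs

section Cyclic

universe w

/-- The element `a ∈ Ω(x)` generates the `C`-set `Ω`. -/
def Generates {C : Type u} [Category.{v} C] (Ω : C ⥤ FintypeCat.{w}) {x : C} (a : Ω.obj x) :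
    Prop :=
  ∀ (y : C) (b : Ω.obj y), ∃ f : x ⟶ y, Ω.map f a = b

/-- Every element of a simple `C`-set generates it. -/
theorem SimpleCSet.generates {C : Type u} [Category.{v} C] {Ω : C ⥤ FintypeCat.{w}}
    (h : SimpleCSet Ω) {x : C} (a : Ω.obj x) : Generates Ω a := by
  have hS : IsSubfunctor Ω fun y => {b | ∃ f : x ⟶ y, Ω.map f a = b} := by
    rintro y z g b ⟨f, rfl⟩
    exact ⟨f ≫ g, by simp⟩
  rcases h.2 _ hS with h | h
  · exact absurd (h x) (Set.Nonempty.ne_empty ⟨a, 𝟙 x, by simp⟩)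
  · intro y b
    exact (h y).ge (Set.mem_univ b)

/-- If `a` generates `Ω` and every relation `Ω(f)(a) = Ω(g)(a)` also holds for `a'` in `Ω'`,
then there is a natural transformation sending `a` to `a'`. -/
theorem Generates.exists_natTrans {C : Type u} [Category.{v} C] {Ω Ω' : C ⥤ FintypeCat.{w}}
    {x : C} {a : Ω.obj x} {a' : Ω'.obj x} (ha : Generates Ω a)
    (h : ∀ (y : C) (f g : x ⟶ y), Ω.map f a = Ω.map g a → Ω'.map f a' = Ω'.map g a') :
    ∃ τ : Ω ⟶ Ω', ∀ (y : C) (f : x ⟶ y), τ.app y (Ω.map f a) = Ω'.map f a' := by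
  choose p hp using ha
  have key (y : C) (f : x ⟶ y) : Ω'.map (p y (Ω.map f a)) a' = Ω'.map f a' :=
    h y _ _ (hp y _)
  refine ⟨{ app := fun y => FintypeCat.homMk fun b => Ω'.map (p y b) a'
            naturality := fun y z g => ?_ }, fun y f => key y f⟩
  ext b
  have := key z (p y b ≫ g)
  simpa [hp] using this

/-- Two `C`-sets with generators over the same object satisfying the same relations are
isomorphic. -/
theorem Generates.nonempty_iso {C : Type u} [Category.{v} C] {Ω Ω' : C ⥤ FintypeCat.{w}}
    {x : C} {a : Ω.obj x} {a' : Ω'.obj x} (ha : Generates Ω a) (ha' : Generates Ω' a')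
    (h : ∀ (y : C) (f g : x ⟶ y), Ω.map f a = Ω.map g a ↔ Ω'.map f a' = Ω'.map g a') :
    Nonempty (Ω ≅ Ω') := by
  obtain ⟨τ, hτ⟩ := ha.exists_natTrans fun y f g => (h y f g).1
  obtain ⟨σ, hσ⟩ := ha'.exists_natTrans fun y f g => (h y f g).2
  refine ⟨⟨τ, σ, ?_, ?_⟩⟩
  · ext y b
    obtain ⟨f, rfl⟩ := ha y b
    exact (congrArg (σ.app y) (hτ y f)).trans (hσ y f)
  · ext y b
    obtain ⟨f, rfl⟩ := ha' y b
    exact (congrArg (τ.app y) (hσ y f)).trans (hτ y f)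

/-- `Ω` is generated by an element over `t.1` whose relations are those recorded in `t.2`. -/
def IsPresentedBy {C : Type u} [Category.{v} C] (Ω : C ⥤ FintypeCat.{w})
    (t : Σ x : C, ∀ y : C, (x ⟶ y) → (x ⟶ y) → Prop) : Prop :=
  ∃ a : Ω.obj t.1, Generates Ω a ∧ ∀ (y : C) (f g : t.1 ⟶ y),
    t.2 y f g ↔ Ω.map f a = Ω.map g a

end Cyclic

/-- Over a finite category there are only finitely many simple `C`-sets up to
isomorphism. -/
theorem finitely_many_simples {C : Type u} [SmallCategory C] [FinCategory C] :
    ∃ (k : ℕ) (Ψ : Fin k → C ⥤ FintypeCat),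
      ∀ Ω : C ⥤ FintypeCat, SimpleCSet Ω → ∃ i, Nonempty (Ω ≅ Ψ i) := by
  let T := {t : Σ x : C, ∀ y : C, (x ⟶ y) → (x ⟶ y) → Prop //
    ∃ Ω : C ⥤ FintypeCat, IsPresentedBy Ω t}
  obtain ⟨k, ⟨e⟩⟩ := Finite.exists_equiv_fin T
  choose Φ hΦ using fun t : T => t.2
  refine ⟨k, fun i => Φ (e.symm i), fun Ω hΩ => ?_⟩
  obtain ⟨x, ⟨a⟩⟩ := hΩ.1
  have ha := hΩ.generates a
  let t : T := ⟨⟨x, fun _ f g => Ω.map f a = Ω.map g a⟩, Ω, a, ha, fun _ _ _ => Iff.rfl⟩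
  obtain ⟨a', ha', h⟩ := hΦ t
  refine ⟨e t, ?_⟩
  beta_reduce
  rw [e.symm_apply_apply]
  exact ha.nonempty_iso ha' h
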